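/- arXiv:1907.05605 — 2 statements merged into one kernel-verified Lean document; each statement's English description precedes it below -/
import Mathlib

section
/- Let S be a nonempty finite set and let μ be a probability measure on F_S. Then the coalescence number satisfies k(μ) = inf{ rank(M_{f_t} M_{f_{t−1}} ⋯ M_{f_1}) : t ≥ 1, f_1, f_2, …, f_t ∈ supp(μ) }, where the rank is taken over the reals. -/
open MeasureTheory

namespace CFTP

variable {S : Type*}

/-- Forward composition `f_t ∘ f_{t-1} ∘ ⋯ ∘ f_1` (functions are indexed by 1,2,…). -/
def fwd (f : ℕ → S → S) : ℕ → S → S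
  | 0 => id
  | t + 1 => f (t + 1) ∘ fwd f t

/-- Backward composition `f_1 ∘ f_2 ∘ ⋯ ∘ f_t`. -/
def bwd (f : ℕ → S → S) : ℕ → S → S
  | 0 => id
  | t + 1 => bwd f t ∘ f (t + 1)

/-- `k_t(f⃗)`: the number of equivalence classes of `i ~ j ↔ f⃗_t i = f⃗_t j`,
i.e. the cardinality of the image of the forward composition. -/
noncomputable def ktF (f : ℕ → S → S) (t : ℕ) : ℕ := Set.ncard (Set.range (fwd f t))

/-- `k_t(f⃖)`: the cardinality of the image of the backward composition. -/
noncomputable def ktB (f : ℕ → S → S) (t : ℕ) : ℕ := Set.ncard (Set.range (bwd f t))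

/-- `k(f⃗)`: the eventual (= minimal) value of the non-increasing sequence `k_t(f⃗)`. -/
noncomputable def kF (f : ℕ → S → S) : ℕ := ⨅ t, ktF f t

/-- `k(f⃖)`. -/
noncomputable def kB (f : ℕ → S → S) : ℕ := ⨅ t, ktB f t

/-- `μbar` is the joint law of an i.i.d. sequence with one-step law `ν`,
i.e. the countable product measure `∏_{s ∈ ℕ} ν`, characterised by its
values on cylinder events. -/
def IsIID [MeasurableSpace S] (ν : Measure (S → S)) (μbar : Measure (ℕ → S → S)) : Prop :=
  ∀ (I : Finset ℕ) (g : ℕ → S → S),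
    μbar {F | ∀ s ∈ I, F s = g s} = ∏ s ∈ I, ν {g s}

/-- The support of a probability measure on the finite set `F_S`. -/
def supp [MeasurableSpace S] (ν : Measure (S → S)) : Set (S → S) := {f | 0 < ν {f}}

/-- A stochastic matrix: nonnegative entries, row sums one. -/
def IsStochastic [Fintype S] (P : S → S → ℝ) : Prop :=
  (∀ i j, 0 ≤ P i j) ∧ ∀ i, ∑ j, P i j = 1

/-- `ν ∈ L(P)`: the measure `ν` on `F_S` is consistent with the matrix `P`. -/
def Consistent [Fintype S] [MeasurableSpace S] (P : S → S → ℝ) (ν : Measure (S → S)) : Prop :=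
  ∀ i j, ν {f : S → S | f i = j} = ENNReal.ofReal (P i j)

/-- Irreducibility: for all `i j` some power of `P` has positive `(i,j)` entry. -/
def Irred [Fintype S] [DecidableEq S] (P : S → S → ℝ) : Prop :=
  ∀ i j, ∃ t, 1 ≤ t ∧ 0 < ((Matrix.of P) ^ t) i j

/-- Aperiodicity: for each `i`, the gcd of `{t ≥ 1 : (P^t)_{i,i} > 0}` is `1`,
expressed as: every common divisor of that set equals `1`. -/
def Aperiodic [Fintype S] [DecidableEq S] (P : S → S → ℝ) : Prop :=
  ∀ i, ∀ d : ℕ, (∀ t, 1 ≤ t → 0 < ((Matrix.of P) ^ t) i i → d ∣ t) → d = 1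

/-- A function is constant. -/
def IsConst (g : S → S) : Prop := ∀ i j, g i = g j

/-- The backward coalescence time `C`. -/
noncomputable def Ctime (F : ℕ → S → S) : ℕ∞ :=
  sInf ((fun t : ℕ => (t : ℕ∞)) '' {t : ℕ | 1 ≤ t ∧ IsConst (bwd F t)})

/-- The forward coalescence time `T`. -/
noncomputable def Ttime (F : ℕ → S → S) : ℕ∞ :=
  sInf ((fun t : ℕ => (t : ℕ∞)) '' {t : ℕ | 1 ≤ t ∧ IsConst (fwd F t)})

/-- The 0-1 matrix `M_f`. -/
noncomputable def Mmat [Fintype S] [DecidableEq S] (f : S → S) : Matrix S S ℝ :=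
  Matrix.of fun i j => if f i = j then 1 else 0

/-- The product `M_{f_t} M_{f_{t-1}} ⋯ M_{f_1}`. -/
noncomputable def Mprod [Fintype S] [DecidableEq S] (f : ℕ → S → S) : ℕ → Matrix S S ℝ
  | 0 => 1
  | t + 1 => Mmat (f (t + 1)) * Mprod f t

/-- The event that states `i` and `j` coalesce. -/
def coalEvent (i j : S) : Set (ℕ → S → S) := {F | ∃ t, 1 ≤ t ∧ fwd F t i = fwd F t j}


lemma fwd_congr (f g : ℕ → S → S) (t : ℕ) (h : ∀ s, 1 ≤ s → s ≤ t → f s = g s) :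
    fwd f t = fwd g t := by
  induction t with
  | zero => rfl
  | succ n ih =>
    simp only [fwd]
    rw [h (n+1) (by omega) le_rfl, ih (fun s h1 h2 => h s h1 (by omega))]

lemma bwd_congr (f g : ℕ → S → S) (t : ℕ) (h : ∀ s, 1 ≤ s → s ≤ t → f s = g s) :
    bwd f t = bwd g t := by
  induction t with
  | zero => rfl
  | succ n ih =>
    simp only [bwd]
    rw [h (n+1) (by omega) le_rfl, ih (fun s h1 h2 => h s h1 (by omega))]

lemma bwd_shift (f : ℕ → S → S) (t : ℕ) :
    bwd f (t + 1) = f 1 ∘ bwd (fun s => f (s + 1)) t := by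
  induction t with
  | zero => rfl
  | succ n ih =>
    rw [bwd, ih]
    rfl

lemma fwd_eq_bwd (g : ℕ → S → S) (t : ℕ) :
    fwd g t = bwd (fun s => g (t + 1 - s)) t := by
  induction t with
  | zero => rfl
  | succ n ih =>
    rw [bwd_shift, fwd, ih]
    simp

lemma bwd_eq_fwd (f : ℕ → S → S) (t : ℕ) :
    bwd f t = fwd (fun s => f (t + 1 - s)) t := by
  rw [fwd_eq_bwd]
  refine bwd_congr _ _ _ fun s h1 h2 => ?_
  have : t + 1 - (t + 1 - s) = s := by omega
  simp only [this]

lemma Mprod_eq [Fintype S] [DecidableEq S] (f : ℕ → S → S) (t : ℕ) :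
    Mprod f t = Mmat (bwd f t) := by
  induction t with
  | zero =>
    ext i j
    simp only [Mprod, Mmat, bwd, Matrix.one_apply, Matrix.of_apply]
    rfl
  | succ n ih =>
    ext i j
    rw [Mprod, ih]
    rw [Matrix.mul_apply, Finset.sum_eq_single (f (n + 1) i)]
    · simp [Mmat, bwd]
      rfl
    · intro b _ hb
      simp [Mmat, hb.symm]
    · simp

lemma rank_Mmat [Fintype S] [DecidableEq S] (h : S → S) :
    (Mmat h).rank = Set.ncard (Set.range h) := by
  have hli : LinearIndependent ℝ (fun x : Set.range h => Pi.basisFun ℝ S (x : S)) :=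
    (Pi.basisFun ℝ S).linearIndependent.comp _ Subtype.val_injective
  have hr : Set.range (Mmat h).row
      = Set.range (fun x : Set.range h => Pi.basisFun ℝ S (x : S)) := by
    have e : (Mmat h).row = (fun x => Pi.basisFun ℝ S (h x)) := by
      ext i j
      simp [Mmat, Matrix.row, Pi.single_apply, eq_comm]
    rw [e]
    ext v
    simp
  rw [Matrix.rank_eq_finrank_span_row, hr, finrank_span_eq_card hli, ← Nat.card_eq_fintype_card]
  rfl

lemma ktF_eq_rank [Fintype S] [DecidableEq S] (g : ℕ → S → S) (t : ℕ) :
    (Mprod (fun s => g (t + 1 - s)) t).rank = ktF g t := by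
  rw [Mprod_eq, rank_Mmat, ← fwd_eq_bwd]
  rfl

lemma ktF_succ_le [Fintype S] (g : ℕ → S → S) (t : ℕ) : ktF g (t + 1) ≤ ktF g t := by
  unfold ktF
  rw [fwd, Set.range_comp]
  exact Set.ncard_image_le (Set.toFinite _)

lemma exists_mem_of_measure_one {Ω : Type*} [MeasurableSpace Ω] (μ : Measure Ω)
    [IsProbabilityMeasure μ] (A B : Set Ω) (hB : MeasurableSet B) (hA : μ A = 1)
    (hp : 0 < μ B) : ∃ x, x ∈ A ∧ x ∈ B := by
  by_contra hc
  push Not at hc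
  have h1 : μ A ≤ μ Bᶜ := measure_mono hc
  rw [hA, prob_compl_eq_one_sub hB] at h1
  exact absurd h1 (not_le.mpr (ENNReal.sub_lt_self ENNReal.one_ne_top one_ne_zero (ne_of_gt hp)))

-- STATEMENT 6
theorem stmt6 [Fintype S] [Nonempty S] [DecidableEq S]
    [MeasurableSpace S] [DiscreteMeasurableSpace S]
    (ν : Measure (S → S)) [IsProbabilityMeasure ν]
    (μbar : Measure (ℕ → S → S)) [IsProbabilityMeasure μbar]
    (hiid : IsIID ν μbar)
    (k : ℕ) (hk : μbar {F | kF F = k} = 1) :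
    k = sInf {r : ℕ | ∃ t, 1 ≤ t ∧ ∃ f : ℕ → S → S,
      (∀ s, 1 ≤ s → s ≤ t → f s ∈ supp ν) ∧ (Mprod f t).rank = r} := by
  apply le_antisymm
  · apply le_csInf
    · have : ∃ f, f ∈ supp ν := by
        by_contra hc
        push Not at hc
        have h0 : ν Set.univ = 0 := by
          rw [← Set.iUnion_of_singleton]
          refine measure_iUnion_null fun f => ?_
          simpa [supp] using hc f
        simp at h0
      obtain ⟨f, hf⟩ := this
      exact ⟨_, 1, le_rfl, fun _ => f, fun _ _ _ => hf, rfl⟩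
    · rintro r ⟨t, ht, f, hf, rfl⟩
      set g : ℕ → S → S := fun s => f (t + 1 - s) with hg
      have hm : MeasurableSet {F : ℕ → S → S | ∀ s ∈ Finset.Icc 1 t, F s = g s} := by
        have : {F : ℕ → S → S | ∀ s ∈ Finset.Icc 1 t, F s = g s}
            = ⋂ s ∈ Finset.Icc 1 t, (fun F : ℕ → S → S => F s) ⁻¹' {g s} := by
          ext F; simp
        rw [this]
        exact Finset.measurableSet_biInter _ fun s _ =>
          measurable_pi_apply s (measurableSet_singleton _)
      have hp : 0 < μbar {F : ℕ → S → S | ∀ s ∈ Finset.Icc 1 t, F s = g s} := by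
        rw [hiid, pos_iff_ne_zero, Finset.prod_ne_zero_iff]
        intro s hs
        rw [Finset.mem_Icc] at hs
        exact (hf (t + 1 - s) (by omega) (by omega)).ne'
      obtain ⟨F, hF, hFg⟩ := exists_mem_of_measure_one μbar _ _ hm hk hp
      have h1 : kF F ≤ ktF F t := ciInf_le (OrderBot.bddBelow _) t
      have h2 : fwd F t = bwd f t := by
        rw [bwd_eq_fwd]
        exact fwd_congr _ _ _ fun s a b => hFg s (Finset.mem_Icc.mpr ⟨a, b⟩)
      rw [Mprod_eq, rank_Mmat, ← h2]
      rw [← (show kF F = k from hF)]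
      exact h1
  · have hae : ∀ᵐ F ∂μbar, ∀ s, F s ∈ supp ν := by
      rw [ae_all_iff]
      intro s
      have : {F : ℕ → S → S | ¬ F s ∈ supp ν}
          ⊆ ⋃ f : ((supp ν)ᶜ : Set (S → S)), {F | F s = f} := by
        intro F hF
        simp only [Set.mem_iUnion]
        exact ⟨⟨F s, hF⟩, rfl⟩
      refine measure_mono_null this (measure_iUnion_null fun f => ?_)
      have h := hiid {s} (fun _ => f)
      have hf := f.2
      simp only [Finset.mem_singleton, forall_eq, Finset.prod_singleton] at h
      rw [h]
      simpa [supp] using hf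
    have : ∃ F, kF F = k ∧ ∀ s, F s ∈ supp ν := by
      by_contra hc
      push Not at hc
      have : μbar {F | kF F = k} = 0 := by
        refine measure_mono_null ?_ hae
        intro F hF
        obtain ⟨s, hs⟩ := hc F hF
        exact fun h => hs (h s)
      rw [hk] at this
      exact one_ne_zero this
    obtain ⟨F, hF, hs⟩ := this
    obtain ⟨t, ht⟩ : ∃ t, ktF F t = kF F := Nat.sInf_mem (Set.range_nonempty (ktF F))
    have h1 : kF F ≤ ktF F (t + 1) := ciInf_le (OrderBot.bddBelow _) (t + 1)
    have h2 := ktF_succ_le F t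
    refine Nat.sInf_le ⟨t + 1, by omega, fun s => F (t + 1 + 1 - s), fun _ _ _ => hs _, ?_⟩
    rw [ktF_eq_rank]
    omega

end CFTP
end

section
/- Let S be a nonempty finite set and let P be an irreducible stochastic matrix on S. Then 1 ∈ K(P) if and only if P is aperiodic; that is, there exists a probability measure μ consistent with P whose coalescence number k(μ) equals 1 if and only if P is aperiodic. -/
open MeasureTheory

namespace CFTP

variable {S : Type*}

section helpers

lemma fwd_add (F : ℕ → S → S) (a b : ℕ) :
    fwd F (a + b) = fwd (fun s => F (a + s)) b ∘ fwd F a := by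
  induction b with
  | zero => rfl
  | succ b ih =>
    show F (a + b + 1) ∘ fwd F (a + b) = (F (a + (b + 1)) ∘ fwd (fun s => F (a + s)) b) ∘ fwd F a
    rw [ih]; rfl

lemma fwd_congr_s8 (F G : ℕ → S → S) (L : ℕ) (h : ∀ s, 1 ≤ s → s ≤ L → F s = G s) :
    fwd F L = fwd G L := by
  induction L with
  | zero => rfl
  | succ L ih =>
    show F (L + 1) ∘ fwd F L = G (L + 1) ∘ fwd G L
    rw [ih (fun s h1 h2 => h s h1 (by omega)), h (L + 1) (by omega) le_rfl]

/-- Compositions of words with letters in `A`. -/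
def Words (A : Set (S → S)) : Set (S → S) :=
  {g | ∃ (L : ℕ) (W : ℕ → S → S), (∀ s, W s ∈ A) ∧ fwd W L = g}

lemma words_comp {A : Set (S → S)} {g h : S → S} (hg : g ∈ Words A) (hh : h ∈ Words A) :
    h ∘ g ∈ Words A := by
  obtain ⟨L, W, hW, rfl⟩ := hg
  obtain ⟨L', W', hW', rfl⟩ := hh
  refine ⟨L + L', fun s => if s ≤ L then W s else W' (s - L), ?_, ?_⟩
  · intro s
    dsimp only
    split_ifs
    · exact hW s
    · exact hW' _
  · rw [fwd_add]
    congr 1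
    · apply fwd_congr_s8
      intro s h1 h2
      rw [if_neg (by omega)]
      congr 1
      omega
    · apply fwd_congr_s8
      intro s h1 h2
      simp [h2]

lemma words_of_mem {A : Set (S → S)} {f : S → S} (hf : f ∈ A) : f ∈ Words A :=
  ⟨1, fun _ => f, fun _ => hf, rfl⟩

lemma words_id {A : Set (S → S)} (hA : A.Nonempty) : id ∈ Words A := by
  obtain ⟨f, hf⟩ := hA
  exact ⟨0, fun _ => f, fun _ => hf, rfl⟩

lemma exists_const_word [Fintype S] {A : Set (S → S)} (hA : A.Nonempty)
    (h : ∀ i j, ∃ g ∈ Words A, g i = g j) : ∃ g ∈ Words A, IsConst g := by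
  classical
  obtain ⟨g, hg, hmin⟩ := WellFounded.has_min
    (InvImage.wf (fun g : S → S => (Set.range g).ncard) Nat.lt_wfRel.wf) (Words A)
    ⟨_, words_id hA⟩
  refine ⟨g, hg, ?_⟩
  intro i j
  by_contra hne
  obtain ⟨k, hk, hkij⟩ := h (g i) (g j)
  apply hmin _ (words_comp hg hk)
  show (Set.range (k ∘ g)).ncard < (Set.range g).ncard
  rw [Set.range_comp]
  refine lt_of_le_of_ne (Set.ncard_image_le (Set.toFinite _)) ?_
  intro heq
  have hinj := (Set.ncard_image_iff (Set.toFinite _)).1 heq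
  exact hne (hinj ⟨i, rfl⟩ ⟨j, rfl⟩ hkij)

section mat
variable [Fintype S] [DecidableEq S] {P : S → S → ℝ}

lemma pow_nn (hP : IsStochastic P) (t : ℕ) : ∀ i j, 0 ≤ ((Matrix.of P) ^ t) i j := by
  induction t with
  | zero =>
    intro i j
    rw [pow_zero, Matrix.one_apply]
    split_ifs <;> norm_num
  | succ t ih =>
    intro i j
    rw [pow_succ, Matrix.mul_apply]
    exact Finset.sum_nonneg fun k _ => mul_nonneg (ih i k) (hP.1 k j)

lemma pow_pos_add (hP : IsStochastic P) {a b : ℕ} {i j k : S}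
    (h1 : 0 < ((Matrix.of P) ^ a) i j) (h2 : 0 < ((Matrix.of P) ^ b) j k) :
    0 < ((Matrix.of P) ^ (a + b)) i k := by
  rw [pow_add, Matrix.mul_apply]
  exact lt_of_lt_of_le (mul_pos h1 h2)
    (Finset.single_le_sum (f := fun j => ((Matrix.of P) ^ a) i j * ((Matrix.of P) ^ b) j k)
      (fun l _ => mul_nonneg (pow_nn hP a i l) (pow_nn hP b l k)) (Finset.mem_univ j))

lemma pow_one_pos {i j : S} : 0 < ((Matrix.of P) ^ 1) i j ↔ 0 < P i j := by
  rw [pow_one]; rfl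

lemma pow_succ_pos (hP : IsStochastic P) {a : ℕ} {i k : S}
    (h : 0 < ((Matrix.of P) ^ (a + 1)) i k) :
    ∃ j, 0 < P i j ∧ 0 < ((Matrix.of P) ^ a) j k := by
  rw [pow_succ', Matrix.mul_apply] at h
  obtain ⟨j, -, hj⟩ := Finset.exists_lt_of_sum_lt (s := Finset.univ) (f := fun _ : S => (0 : ℝ))
    (by simpa using h)
  refine ⟨j, ?_, ?_⟩
  · exact lt_of_le_of_ne (hP.1 i j) fun h0 => by
      rw [← h0, zero_mul] at hj
      exact lt_irrefl _ hj
  · exact lt_of_le_of_ne (pow_nn hP a j k) fun h0 => by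
      rw [← h0] at hj
      simp at hj

lemma exists_pos (hP : IsStochastic P) (i : S) : ∃ j, 0 < P i j := by
  by_contra hcon
  push Not at hcon
  have h1 := hP.2 i
  have h2 : ∑ j, P i j ≤ 0 := Finset.sum_nonpos fun j _ => hcon j
  linarith

lemma fwd_reach (hP : IsStochastic P) {F : ℕ → S → S} (hF : ∀ s i, 0 < P i (F s i)) (t : ℕ)
    (i : S) : 0 < ((Matrix.of P) ^ t) i (fwd F t i) := by
  induction t with
  | zero => simp [fwd]
  | succ t ih => exact pow_pos_add hP ih (pow_one_pos.2 (hF (t + 1) (fwd F t i)))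

/-- Aperiodic irreducible: any two states can meet. -/
lemma exists_meet (hP : IsStochastic P) (hirr : Irred P) (hap : Aperiodic P) (i j : S) :
    ∃ n z, 0 < ((Matrix.of P) ^ n) i z ∧ 0 < ((Matrix.of P) ^ n) j z := by
  let T : Set ℕ := {t | 1 ≤ t ∧ 0 < ((Matrix.of P) ^ t) i i}
  have hg : Nat.setGcd T = 1 := hap i _ fun t h1 h2 => Nat.setGcd_dvd_of_mem (s := T) ⟨h1, h2⟩
  obtain ⟨n, hn⟩ := Nat.exists_mem_closure_of_ge T
  have hcl : ∀ m ∈ AddSubmonoid.closure T, 0 < ((Matrix.of P) ^ m) i i := by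
    intro m hm
    induction hm using AddSubmonoid.closure_induction with
    | mem x hx => exact hx.2
    | zero => simp
    | add x y _ _ hx hy => exact pow_pos_add hP hx hy
  have hbig : ∀ m ≥ n, 0 < ((Matrix.of P) ^ m) i i := fun m hm =>
    hcl m (hn m hm (by rw [hg]; exact one_dvd _))
  obtain ⟨b, -, hb⟩ := hirr j i
  exact ⟨b + n, i, hbig _ (by omega), pow_pos_add hP hb (hbig n le_rfl)⟩

lemma merge (hP : IsStochastic P) (n : ℕ) : ∀ i j z : S,
    0 < ((Matrix.of P) ^ n) i z → 0 < ((Matrix.of P) ^ n) j z →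
    ∃ g ∈ Words {f : S → S | ∀ i, 0 < P i (f i)}, g i = g j := by
  have hne : {f : S → S | ∀ i, 0 < P i (f i)}.Nonempty := by
    choose f hf using exists_pos hP
    exact ⟨f, hf⟩
  induction n with
  | zero =>
    intro i j z hi hj
    refine ⟨id, words_id hne, ?_⟩
    rw [pow_zero, Matrix.one_apply] at hi hj
    split_ifs at hi hj with h1 h2
    · rw [h1, h2]
    all_goals simp at hi hj
  | succ n ih =>
    intro i j z hi hj
    by_cases hij : i = j
    · exact ⟨id, words_id hne, by rw [hij]⟩
    obtain ⟨i', hi1, hi2⟩ := pow_succ_pos hP hi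
    obtain ⟨j', hj1, hj2⟩ := pow_succ_pos hP hj
    obtain ⟨g, hg, hgij⟩ := ih i' j' z hi2 hj2
    obtain ⟨f, hf⟩ := hne
    let f' : S → S := Function.update (Function.update f i i') j j'
    have hf' : f' ∈ {f : S → S | ∀ i, 0 < P i (f i)} := by
      intro k
      by_cases hkj : k = j
      · subst hkj; simpa [f'] using hj1
      by_cases hki : k = i
      · subst hki; simpa [f', hkj] using hi1
      simpa [f', hkj, hki] using hf k
    refine ⟨g ∘ f', words_comp (words_of_mem hf') hg, ?_⟩
    simpa [f', hij] using hgij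

end mat

lemma kF_eq_one_iff [Fintype S] [Nonempty S] (F : ℕ → S → S) :
    kF F = 1 ↔ ∃ t, IsConst (fwd F t) := by
  have hkt : ∀ t, ktF F t = 1 ↔ IsConst (fwd F t) := by
    intro t
    unfold ktF
    rw [Set.ncard_eq_one]
    constructor
    · rintro ⟨a, ha⟩ i j
      have h1 : fwd F t i ∈ ({a} : Set S) := ha ▸ ⟨i, rfl⟩
      have h2 : fwd F t j ∈ ({a} : Set S) := ha ▸ ⟨j, rfl⟩
      exact h1.trans h2.symm
    · intro h
      obtain ⟨i⟩ := ‹Nonempty S›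
      refine ⟨fwd F t i, ?_⟩
      ext x
      constructor
      · rintro ⟨j, rfl⟩; exact h j i
      · intro hx; exact ⟨i, hx.symm⟩
  have hpos : ∀ t, 1 ≤ ktF F t := fun t =>
    (Set.ncard_pos (Set.toFinite _)).2 (Set.range_nonempty _)
  constructor
  · intro h
    obtain ⟨t, ht⟩ := Nat.sInf_mem (Set.range_nonempty (fun t => ktF F t))
    exact ⟨t, (hkt t).1 (ht.trans h)⟩
  · rintro ⟨t, ht⟩
    apply le_antisymm
    · exact (ciInf_le (OrderBot.bddBelow _) t).trans ((hkt t).2 ht).le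
    · exact le_ciInf hpos

lemma prob_one [Fintype S] [Nonempty S] [MeasurableSpace S] [DiscreteMeasurableSpace S]
    {ν : Measure (S → S)} {μ : Measure (ℕ → S → S)} [IsProbabilityMeasure μ] (hiid : IsIID ν μ)
    {g : S → S} (hg : g ∈ Words {f | ν {f} ≠ 0}) (hc : IsConst g) :
    μ {F | kF F = 1} = 1 := by
  obtain ⟨L₀, W₀, hW, rfl⟩ := hg
  obtain ⟨L, hL, hcL⟩ : ∃ L, 0 < L ∧ IsConst (fwd W₀ L) :=
    ⟨L₀ + 1, Nat.succ_pos _, fun i j => congrArg (W₀ (L₀ + 1)) (hc i j)⟩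
  let W : ℕ → S → S := fun s => W₀ ((s - 1) % L + 1)
  let B : ℕ → Finset ℕ := fun m => (Finset.range L).map (addLeftEmbedding (m * L + 1))
  have hB : ∀ m s, s ∈ B m → (s - 1) / L = m := by
    intro m s hs
    simp only [B, Finset.mem_map, Finset.mem_range, addLeftEmbedding_apply] at hs
    obtain ⟨k, hk, rfl⟩ := hs
    rw [show m * L + 1 + k - 1 = k + m * L by omega, Nat.add_mul_div_right _ _ hL,
      Nat.div_eq_of_lt hk, zero_add]
  let A : ℕ → Set (ℕ → S → S) := fun m => {F | ∀ s ∈ B m, F s = W s}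
  have hA : ∀ m, μ (A m) = ∏ k ∈ Finset.range L, ν {W₀ (k + 1)} := by
    intro m
    show μ {F | ∀ s ∈ B m, F s = W s} = _
    rw [hiid (B m) W, Finset.prod_map]
    apply Finset.prod_congr rfl
    intro k hk
    have hk' := Finset.mem_range.1 hk
    simp only [W, addLeftEmbedding_apply]
    rw [show m * L + 1 + k - 1 = k + m * L by omega, Nat.add_mul_mod_self_right,
      Nat.mod_eq_of_lt hk']
  have hmeas : ∀ m, MeasurableSet (A m) := by
    intro m
    have : A m = ⋂ s ∈ B m, (fun F : ℕ → S → S => F s) ⁻¹' {W s} := by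
      ext F; simp [A]
    rw [this]
    exact Finset.measurableSet_biInter _ fun s _ =>
      (measurable_pi_apply s) (measurableSet_singleton _)
  have hind : ProbabilityTheory.iIndepSet A μ := by
    rw [ProbabilityTheory.iIndepSet_iff_meas_biInter hmeas]
    intro I
    have : (⋂ m ∈ I, A m) = {F | ∀ s ∈ I.biUnion B, F s = W s} := by
      ext F
      simp only [A, Set.mem_iInter, Set.mem_ofPred_eq, Finset.mem_biUnion]
      constructor
      · rintro h s ⟨m, hm, hs⟩; exact h m hm s hs
      · intro h m hm s hs; exact h s ⟨m, hm, hs⟩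
    rw [this, hiid, Finset.prod_biUnion]
    · exact Finset.prod_congr rfl fun m _ => (hiid (B m) W).symm
    · intro m _ m' _ hne
      apply Finset.disjoint_left.2
      intro s hs hs'
      exact hne ((hB m s hs).symm.trans (hB m' s hs'))
  have hlim := ProbabilityTheory.measure_limsup_eq_one hmeas hind (by
    simp_rw [hA]
    apply ENNReal.tsum_const_eq_top_of_ne_zero
    exact Finset.prod_ne_zero_iff.2 fun k _ => hW _)
  apply le_antisymm prob_le_one
  rw [← hlim]
  apply measure_mono
  intro F hF
  rw [Filter.limsup_eq_iInf_iSup_of_nat] at hF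
  have h0 : F ∈ ⋃ i, ⋃ (_ : i ≥ 0), A i := by
    have := Set.mem_iInter.1 hF 0
    simpa using this
  simp only [Set.mem_iUnion] at h0
  obtain ⟨m, -, hm⟩ := h0
  refine (kF_eq_one_iff F).2 ⟨m * L + L, ?_⟩
  rw [fwd_add]
  have : fwd (fun s => F (m * L + s)) L = fwd W₀ L := by
    apply fwd_congr_s8
    intro s h1 h2
    have hs : m * L + s ∈ B m := by
      simp only [B, Finset.mem_map, Finset.mem_range, addLeftEmbedding_apply]
      exact ⟨s - 1, by omega, by omega⟩
    show F (m * L + s) = W₀ s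
    rw [hm _ hs]
    simp only [W]
    rw [show m * L + s - 1 = (s - 1) + m * L by omega, Nat.add_mul_mod_self_right,
      Nat.mod_eq_of_lt (by omega)]
    congr 1
    omega
  rw [this]
  exact fun i j => hcL _ _

lemma exists_iid [Fintype S] [MeasurableSpace S] [DiscreteMeasurableSpace S]
    (ν : Measure (S → S)) [IsProbabilityMeasure ν] :
    ∃ μ : Measure (ℕ → S → S), IsProbabilityMeasure μ ∧ IsIID ν μ := by
  refine ⟨Measure.infinitePi fun _ => ν, inferInstance, ?_⟩
  intro I g
  rw [← Measure.infinitePi_pi (fun _ : ℕ => ν) (s := I) (t := fun s => {g s})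
    fun s _ => measurableSet_singleton _]
  congr 1

lemma exists_coupling [Fintype S] [MeasurableSpace S] [DiscreteMeasurableSpace S]
    {P : S → S → ℝ} (hP : IsStochastic P) :
    ∃ ν : Measure (S → S), IsProbabilityMeasure ν ∧ Consistent P ν ∧
      ∀ f : S → S, (∀ i, 0 < P i (f i)) → ν {f} ≠ 0 := by
  let p : S → PMF S := fun i => PMF.ofFintype (fun j => ENNReal.ofReal (P i j)) (by
    rw [← ENNReal.ofReal_sum_of_nonneg fun j _ => hP.1 i j, hP.2 i, ENNReal.ofReal_one])
  have hp : ∀ i j, (p i).toMeasure {j} = ENNReal.ofReal (P i j) := by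
    intro i j
    rw [PMF.toMeasure_apply_singleton _ _ (measurableSet_singleton _)]
    rfl
  refine ⟨Measure.pi fun i => (p i).toMeasure, inferInstance, ?_, ?_⟩
  · intro i j
    rw [← hp i j, ← (measurePreserving_eval (fun i => (p i).toMeasure) i).measure_preimage
      (measurableSet_singleton j).nullMeasurableSet]
    rfl
  · intro f hf
    rw [Measure.pi_singleton]
    refine Finset.prod_ne_zero_iff.2 fun i _ => ?_
    rw [hp]
    simpa using hf i

lemma exists_good [Fintype S] [MeasurableSpace S] 
    {ν : Measure (S → S)} {μ : Measure (ℕ → S → S)} [IsProbabilityMeasure μ] (hiid : IsIID ν μ)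
    (h : μ {F | kF F = 1} = 1) : ∃ F : ℕ → S → S, kF F = 1 ∧ ∀ s, ν {F s} ≠ 0 := by
  by_contra hcon
  push Not at hcon
  have hsub : {F : ℕ → S → S | kF F = 1} ⊆
      ⋃ (s : ℕ) (f : {f : S → S // ν {f} = 0}), {F | F s = f.1} := by
    intro F hF
    obtain ⟨s, hs⟩ := hcon F hF
    simp only [Set.mem_iUnion]
    exact ⟨s, ⟨F s, hs⟩, rfl⟩
  have hz : μ (⋃ (s : ℕ) (f : {f : S → S // ν {f} = 0}), {F | F s = f.1}) = 0 := by
    rw [measure_iUnion_null_iff]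
    intro s
    rw [measure_iUnion_null_iff]
    intro f
    have := hiid {s} (fun _ => f.1)
    simpa [f.2] using this
  have := measure_mono_null hsub hz
  rw [h] at this
  exact one_ne_zero this

end helpers

-- STATEMENT 8
theorem stmt8 [Fintype S] [Nonempty S] [DecidableEq S]
    [MeasurableSpace S] [DiscreteMeasurableSpace S]
    (P : S → S → ℝ) (hP : IsStochastic P) (hirr : Irred P) :
    (∃ ν : Measure (S → S), IsProbabilityMeasure ν ∧ Consistent P ν ∧
      ∃ μbar : Measure (ℕ → S → S), IsProbabilityMeasure μbar ∧ IsIID ν μbar ∧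
        μbar {F | kF F = 1} = 1) ↔ Aperiodic P := by
  constructor
  · rintro ⟨ν, hν, hcons, μ, hμ, hiid, h1⟩
    obtain ⟨F, hF, hsupp⟩ := exists_good hiid h1
    obtain ⟨t, ht⟩ := (kF_eq_one_iff F).1 hF
    have hpos : ∀ s i, 0 < P i (F s i) := by
      intro s i
      by_contra hn
      apply hsupp s
      refine measure_mono_null (t := {f : S → S | f i = F s i}) ?_ ?_
      · rintro f rfl; rfl
      · rw [hcons, ENNReal.ofReal_eq_zero]
        exact not_lt.1 hn
    intro i d hd
    have hreach : ∀ j, 0 < ((Matrix.of P) ^ t) j (fwd F t i) := by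
      intro j
      rw [ht i j]
      exact fwd_reach hP hpos t j
    obtain ⟨j, hj⟩ := exists_pos hP i
    obtain ⟨r, hr, hri⟩ := hirr (fwd F t i) i
    have e1 := hd (t + r) (by omega) (pow_pos_add hP (hreach i) hri)
    have e2 := hd (1 + (t + r)) (by omega)
      (pow_pos_add hP (pow_one_pos.2 hj) (pow_pos_add hP (hreach j) hri))
    exact Nat.dvd_one.1 ((Nat.dvd_add_left e1).1 e2)
  · intro hap
    obtain ⟨ν, hν, hcons, hsupp⟩ := exists_coupling hP
    obtain ⟨μ, hμ, hiid⟩ := exists_iid ν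
    refine ⟨ν, hν, hcons, μ, hμ, hiid, ?_⟩
    have hne : {f : S → S | ∀ i, 0 < P i (f i)}.Nonempty := by
      choose f hf using exists_pos hP
      exact ⟨f, hf⟩
    obtain ⟨g, ⟨L, W, hW, hWg⟩, hc⟩ := exists_const_word hne fun i j => by
      obtain ⟨n, z, h1, h2⟩ := exists_meet hP hirr hap i j
      exact merge hP n i j z h1 h2
    exact prob_one hiid ⟨L, W, fun s => hsupp _ (hW s), hWg⟩ hc

end CFTP
end
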